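/- arXiv:1008.0095 — 2 statements merged into one kernel-verified Lean document; each statement's English description precedes it below -/
import Mathlib

section
/- Let k be a field, I a well-ordered set, and C⁰ → C¹ → C² → C³ → C⁴ a complex of k-vector spaces (the composite of any two consecutive differentials is zero), each term carrying an increasing exhaustive I-filtration preserved by all the differentials. Assume that for every α ∈ I the associated graded complex gr_α C⁰ → gr_α C¹ → gr_α C² → gr_α C³ → gr_α C⁴ is exact at gr_α C¹ and at gr_α C³, and assume that the original complex is exact at C². Then for every α ∈ I the associated graded complex is exact at gr_α C². -/
open Submodule

section GradedPieces

variable {k : Type*} [Field k]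

/-- The sum `Σ_{β < α} F β` of the filtration pieces strictly below `α`. -/
abbrev filtBelow {I V : Type*} [LinearOrder I] [AddCommGroup V] [Module k V]
    (F : I → Submodule k V) (α : I) : Submodule k V :=
  ⨆ β ∈ Set.Iio α, F β

/-- The associated graded piece `gr_α V = F_α V / Σ_{β < α} F_β V` of an `I`-filtered
vector space. -/
abbrev filtGr {I V : Type*} [LinearOrder I] [AddCommGroup V] [Module k V]
    (F : I → Submodule k V) (α : I) : Type _ :=
  ↥(F α) ⧸ (filtBelow F α).comap (F α).subtype

/-- The map induced on associated graded pieces by a filtration-preserving linear map. -/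
def filtGrMap {I V W : Type*} [LinearOrder I] [AddCommGroup V] [Module k V]
    [AddCommGroup W] [Module k W] (F : I → Submodule k V) (G : I → Submodule k W)
    (f : V →ₗ[k] W) (hf : ∀ α : I, ∀ x ∈ F α, f x ∈ G α) (α : I) :
    filtGr F α →ₗ[k] filtGr G α :=
  Submodule.mapQ _ _ (f.restrict (hf α)) (by
    have key : filtBelow F α ≤ (filtBelow G α).comap f := by
      refine iSup₂_le fun β hβ => ?_
      intro y hy
      exact Submodule.mem_comap.mpr
        (le_iSup₂ (f := fun (β : I) (_ : β ∈ Set.Iio α) => G β) β hβ (hf β y hy))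
    intro x hx
    simp only [Submodule.mem_comap] at hx ⊢
    exact key hx)

end GradedPieces

section GradedPieces

variable {k I : Type*} [Field k] [LinearOrder I]
  {U V W : Type*} [AddCommGroup U] [Module k U] [AddCommGroup V] [Module k V]
  [AddCommGroup W] [Module k W]

theorem mem_filtBelow_iff {F : I → Submodule k V} (hF : Monotone F) {α : I} {x : V} :
    x ∈ filtBelow F α ↔ x = 0 ∨ ∃ β < α, x ∈ F β := by
  constructor
  · intro hx
    rcases Set.eq_empty_or_nonempty (Set.Iio α) with h | h
    · left
      simpa [filtBelow, h] using hx
    · right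
      have : Nonempty (Set.Iio α) := h.to_subtype
      have hmono : Monotone fun β : Set.Iio α => F β := fun _ _ hβγ => hF hβγ
      rw [filtBelow, iSup_subtype', Submodule.mem_iSup_of_directed _ hmono.directed_le] at hx
      obtain ⟨⟨β, hβ⟩, hxβ⟩ := hx
      exact ⟨β, hβ, hxβ⟩
  · rintro (rfl | ⟨β, hβ, hx⟩)
    · exact zero_mem _
    · exact le_iSup₂ (f := fun (β : I) (_ : β ∈ Set.Iio α) => F β) β hβ hx

/-- Exactness of the graded pieces, expressed with elements of the filtered spaces. -/
theorem ker_filtGrMap_le_range_iff {E : I → Submodule k U} {F : I → Submodule k V}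
    {G : I → Submodule k W} {e : U →ₗ[k] V} {f : V →ₗ[k] W}
    (he : ∀ α : I, ∀ x ∈ E α, e x ∈ F α) (hf : ∀ α : I, ∀ x ∈ F α, f x ∈ G α) (α : I) :
    LinearMap.ker (filtGrMap F G f hf α) ≤ LinearMap.range (filtGrMap E F e he α) ↔
      ∀ x ∈ F α, f x ∈ filtBelow G α → ∃ z ∈ E α, x - e z ∈ filtBelow F α := by
  constructor
  · intro h x hx hfx
    have hker : Submodule.Quotient.mk ⟨x, hx⟩ ∈ LinearMap.ker (filtGrMap F G f hf α) :=
      (Submodule.Quotient.mk_eq_zero _).2 hfx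
    obtain ⟨q, hq⟩ := h hker
    obtain ⟨z, rfl⟩ := Submodule.Quotient.mk_surjective _ q
    exact ⟨z, z.2, (Submodule.Quotient.eq ((filtBelow F α).comap (F α).subtype)).1 hq.symm⟩
  · intro h q hq
    obtain ⟨x, rfl⟩ := Submodule.Quotient.mk_surjective _ q
    obtain ⟨z, hz, hxz⟩ := h x x.2
      ((Submodule.Quotient.mk_eq_zero ((filtBelow G α).comap (G α).subtype)).1 hq)
    exact ⟨Submodule.Quotient.mk ⟨z, hz⟩,
      ((Submodule.Quotient.eq ((filtBelow F α).comap (F α).subtype)).2 hxz).symm⟩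

theorem range_filtGrMap_le_ker {E : I → Submodule k U} {F : I → Submodule k V}
    {G : I → Submodule k W} {e : U →ₗ[k] V} {f : V →ₗ[k] W}
    (he : ∀ α : I, ∀ x ∈ E α, e x ∈ F α) (hf : ∀ α : I, ∀ x ∈ F α, f x ∈ G α)
    (hfe : ∀ x, f (e x) = 0) (α : I) :
    LinearMap.range (filtGrMap E F e he α) ≤ LinearMap.ker (filtGrMap F G f hf α) := by
  rintro _ ⟨q, rfl⟩
  obtain ⟨z, rfl⟩ := Submodule.Quotient.mk_surjective _ q
  refine (Submodule.Quotient.mk_eq_zero _).2 ?_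
  change f (e z) ∈ filtBelow G α
  rw [hfe]
  exact zero_mem _

variable [WellFoundedLT I]

/-- If the graded pieces are exact in the middle, then the outgoing map is strict. -/
theorem exists_mem_map_eq_of_gr_exact {E : I → Submodule k U} {F : I → Submodule k V}
    {G : I → Submodule k W} {e : U →ₗ[k] V} {f : V →ₗ[k] W}
    (he : ∀ α : I, ∀ x ∈ E α, e x ∈ F α) (hf : ∀ α : I, ∀ x ∈ F α, f x ∈ G α)
    (hfe : ∀ x, f (e x) = 0) (hF : Monotone F) (hG : Monotone G)
    (hgr : ∀ α, LinearMap.ker (filtGrMap F G f hf α) ≤ LinearMap.range (filtGrMap E F e he α))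
    {β γ : I} {y : V} (hy : y ∈ F γ) (hfy : f y ∈ G β) : ∃ x ∈ F β, f x = f y := by
  induction γ using WellFoundedLT.induction generalizing y with
  | ind γ ih =>
    rcases le_or_gt γ β with h | h
    · exact ⟨y, hF h hy, rfl⟩
    · obtain ⟨z, -, hyz⟩ := (ker_filtGrMap_le_range_iff he hf γ).1 (hgr γ) y hy
        ((mem_filtBelow_iff hG).2 (Or.inr ⟨β, h, hfy⟩))
      have hfyz : f (y - e z) = f y := by rw [map_sub, hfe, sub_zero]
      rcases (mem_filtBelow_iff hF).1 hyz with h0 | ⟨δ, hδ, hyδ⟩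
      · exact ⟨0, zero_mem _, by rw [← hfyz, h0]⟩
      · obtain ⟨x, hx, hfx⟩ := ih δ hδ hyδ (hfyz.symm ▸ hfy)
        exact ⟨x, hx, hfx.trans hfyz⟩

/-- If the graded pieces are exact in the middle, then every cycle in a filtration piece is
the image of an element of the same filtration piece. -/
theorem exists_mem_map_eq_of_map_eq_zero {E : I → Submodule k U} {F : I → Submodule k V}
    {G : I → Submodule k W} {e : U →ₗ[k] V} {f : V →ₗ[k] W}
    (he : ∀ α : I, ∀ x ∈ E α, e x ∈ F α) (hf : ∀ α : I, ∀ x ∈ F α, f x ∈ G α)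
    (hfe : ∀ x, f (e x) = 0) (hE : Monotone E) (hF : Monotone F)
    (hgr : ∀ α, LinearMap.ker (filtGrMap F G f hf α) ≤ LinearMap.range (filtGrMap E F e he α))
    {β : I} {y : V} (hy : y ∈ F β) (hfy : f y = 0) : ∃ x ∈ E β, e x = y := by
  induction β using WellFoundedLT.induction generalizing y with
  | ind β ih =>
    obtain ⟨z, hz, hyz⟩ := (ker_filtGrMap_le_range_iff he hf β).1 (hgr β) y hy
      (hfy.symm ▸ zero_mem _)
    rcases (mem_filtBelow_iff hF).1 hyz with h0 | ⟨δ, hδ, hyδ⟩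
    · exact ⟨z, hz, (sub_eq_zero.1 h0).symm⟩
    · obtain ⟨x, hx, hex⟩ := ih δ hδ hyδ (by rw [map_sub, hfe, hfy, sub_zero])
      exact ⟨x + z, add_mem (hE hδ.le hx) hz, by rw [map_add, hex, sub_add_cancel]⟩

end GradedPieces

/-- Given a complex `C⁰ → C¹ → C² → C³ → C⁴` of `I`-filtered vector spaces
(with `I` well-ordered and the filtrations increasing, exhaustive and preserved by the
differentials), if the associated graded complex is exact at `gr_α C¹` and `gr_α C³` for
every `α` and the original complex is exact at `C²`, then the associated graded complex
is exact at `gr_α C²` for every `α`. -/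
theorem gr_exact_of_exact
    {k I : Type*} [Field k] [LinearOrder I] [WellFoundedLT I]
    {C₀ C₁ C₂ C₃ C₄ : Type*}
    [AddCommGroup C₀] [Module k C₀] [AddCommGroup C₁] [Module k C₁]
    [AddCommGroup C₂] [Module k C₂] [AddCommGroup C₃] [Module k C₃]
    [AddCommGroup C₄] [Module k C₄]
    (d₀ : C₀ →ₗ[k] C₁) (d₁ : C₁ →ₗ[k] C₂) (d₂ : C₂ →ₗ[k] C₃) (d₃ : C₃ →ₗ[k] C₄)
    (h₁₀ : ∀ x : C₀, d₁ (d₀ x) = 0) (h₂₁ : ∀ x : C₁, d₂ (d₁ x) = 0)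
    (h₃₂ : ∀ x : C₂, d₃ (d₂ x) = 0)
    (F₀ : I → Submodule k C₀) (F₁ : I → Submodule k C₁) (F₂ : I → Submodule k C₂)
    (F₃ : I → Submodule k C₃) (F₄ : I → Submodule k C₄)
    (hmono₀ : Monotone F₀) (hmono₁ : Monotone F₁) (hmono₂ : Monotone F₂)
    (hmono₃ : Monotone F₃) (hmono₄ : Monotone F₄)
    (hexh₀ : ⨆ α, F₀ α = ⊤) (hexh₁ : ⨆ α, F₁ α = ⊤) (hexh₂ : ⨆ α, F₂ α = ⊤)
    (hexh₃ : ⨆ α, F₃ α = ⊤) (hexh₄ : ⨆ α, F₄ α = ⊤)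
    (hd₀ : ∀ α : I, ∀ x ∈ F₀ α, d₀ x ∈ F₁ α) (hd₁ : ∀ α : I, ∀ x ∈ F₁ α, d₁ x ∈ F₂ α)
    (hd₂ : ∀ α : I, ∀ x ∈ F₂ α, d₂ x ∈ F₃ α) (hd₃ : ∀ α : I, ∀ x ∈ F₃ α, d₃ x ∈ F₄ α)
    (hgr₁ : ∀ α : I, LinearMap.ker (filtGrMap F₁ F₂ d₁ hd₁ α)
      = LinearMap.range (filtGrMap F₀ F₁ d₀ hd₀ α))
    (hgr₃ : ∀ α : I, LinearMap.ker (filtGrMap F₃ F₄ d₃ hd₃ α)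
      = LinearMap.range (filtGrMap F₂ F₃ d₂ hd₂ α))
    (hexact : LinearMap.ker d₂ = LinearMap.range d₁) :
    ∀ α : I, LinearMap.ker (filtGrMap F₂ F₃ d₂ hd₂ α)
      = LinearMap.range (filtGrMap F₁ F₂ d₁ hd₁ α) := by
  intro α
  refine le_antisymm ((ker_filtGrMap_le_range_iff hd₁ hd₂ α).2 fun x hx hdx => ?_)
    (range_filtGrMap_le_ker hd₁ hd₂ h₂₁ α)
  obtain ⟨x', hx', hdx'⟩ : ∃ x' ∈ filtBelow F₂ α, d₂ x' = d₂ x := by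
    rcases (mem_filtBelow_iff hmono₃).1 hdx with h0 | ⟨β, hβ, hxβ⟩
    · exact ⟨0, zero_mem _, by rw [h0, map_zero]⟩
    · obtain ⟨x', hx', hdx'⟩ := exists_mem_map_eq_of_map_eq_zero hd₂ hd₃ h₃₂ hmono₂ hmono₃
        (fun γ => (hgr₃ γ).le) hxβ (h₃₂ x)
      exact ⟨x', (mem_filtBelow_iff hmono₂).2 (Or.inr ⟨β, hβ, hx'⟩), hdx'⟩
  have hbelow : filtBelow F₂ α ≤ F₂ α := iSup₂_le fun β hβ => hmono₂ (le_of_lt hβ)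
  obtain ⟨y, hy⟩ : x - x' ∈ LinearMap.range d₁ := by
    rw [← hexact, LinearMap.mem_ker, map_sub, hdx', sub_self]
  have hyα : d₁ y ∈ F₂ α := hy ▸ sub_mem hx (hbelow hx')
  have hytop : y ∈ ⨆ γ, F₁ γ := hexh₁ ▸ Submodule.mem_top
  have : Nonempty I := ⟨α⟩
  obtain ⟨γ, hγ⟩ := (Submodule.mem_iSup_of_directed F₁ hmono₁.directed_le).1 hytop
  obtain ⟨z, hz, hdz⟩ := exists_mem_map_eq_of_gr_exact hd₀ hd₁ h₁₀ hmono₁ hmono₂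
    (fun γ => (hgr₁ γ).le) hγ hyα
  exact ⟨z, hz, by rwa [hdz, hy, sub_sub_cancel]⟩
end

section
/- Let p and l be distinct prime numbers and let K be a finite field extension of the p-adic field ℚ_p. If K contains a primitive l-th root of unity, then the quotient group Kˣ/(Kˣ)^l is finite of cardinality l². -/
theorem MonoidHom.index_range_powMonoidHom_eq_of_surjective {G H : Type*} [CommGroup G] [CommGroup H]
    (f : G →* H) (hf : Function.Surjective f) (n : ℕ)
    (hker : f.ker ≤ (powMonoidHom n : G →* G).range) :
    (powMonoidHom n : G →* G).range.index = (powMonoidHom n : H →* H).range.index := by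
  rw [← Subgroup.index_comap_of_surjective _ hf]
  congr 1
  ext x
  constructor
  · rintro ⟨y, rfl⟩
    exact ⟨f y, by simp⟩
  · rintro ⟨y, hy⟩
    obtain ⟨z, rfl⟩ := hf y
    obtain ⟨w, hw⟩ := hker (show x / z ^ n ∈ f.ker by simp_all [MonoidHom.mem_ker])
    refine ⟨w * z, ?_⟩
    simp_all [mul_pow]

theorem index_range_powMonoidHom_prod (G H : Type*) [CommGroup G] [CommGroup H] (n : ℕ) :
    (powMonoidHom n : G × H →* G × H).range.index =
      (powMonoidHom n : G →* G).range.index * (powMonoidHom n : H →* H).range.index := by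
  rw [← Subgroup.index_prod]
  congr 1
  ext ⟨x, y⟩
  simp [Subgroup.mem_prod, Prod.ext_iff]

theorem index_range_powMonoidHom_multiplicative_int (n : ℕ) :
    (powMonoidHom n : Multiplicative ℤ →* Multiplicative ℤ).range.index = n := by
  have : (powMonoidHom n : Multiplicative ℤ →* Multiplicative ℤ).range =
      (AddSubgroup.zmultiples (n : ℤ)).toSubgroup := by
    ext x
    simp only [MonoidHom.mem_range, powMonoidHom_apply]
    constructor
    · rintro ⟨y, rfl⟩
      exact ⟨y.toAdd, by simp [mul_comm, toAdd_pow]⟩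
    · rintro ⟨y, hy⟩
      exact ⟨.ofAdd y, by rw [← ofAdd_toAdd x, ← hy, ← ofAdd_nsmul]; simp [mul_comm]⟩
  rw [this, AddSubgroup.index_toSubgroup, Int.index_zmultiples, Int.natAbs_natCast]

section DVR

variable {R : Type*} [CommRing R]

theorem index_range_powMonoidHom_units_of_henselian [HenselianLocalRing R]
    {n : ℕ} (hn : IsUnit (n : R)) :
    (powMonoidHom n : Rˣ →* Rˣ).range.index =
      (powMonoidHom n : (IsLocalRing.ResidueField R)ˣ →* _).range.index := by
  refine MonoidHom.index_range_powMonoidHom_eq_of_surjective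
    (Units.map (IsLocalRing.residue R : R →* IsLocalRing.ResidueField R))
    (IsLocalRing.surjective_units_map_of_local_ringHom _ IsLocalRing.residue_surjective
      inferInstance) n ?_
  intro u hu
  have hn0 : n ≠ 0 := by rintro rfl; simp at hn
  have hu : IsLocalRing.residue R u = 1 := by simpa [Units.ext_iff] using hu
  obtain ⟨a, ha, -⟩ := HenselianLocalRing.is_henselian (Polynomial.X ^ n - Polynomial.C (u : R))
    (Polynomial.monic_X_pow_sub_C _ hn0) 1
    (by rw [← IsLocalRing.residue_eq_zero_iff]; simp [hu])
    (by simpa [Polynomial.derivative_X_pow] using hn)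
  have ha : a ^ n = u := by simpa [sub_eq_zero] using ha
  have hau : IsUnit a := (isUnit_pow_iff hn0).mp (ha ▸ u.isUnit)
  exact ⟨hau.unit, by ext; simpa using ha⟩

theorem IsLocalRing.eq_one_of_pow_eq_one_of_residue_eq_one [IsDomain R] [IsLocalRing R] {n : ℕ}
    (hn : IsUnit (n : R)) {x : R} (hx : x ^ n = 1) (hx1 : residue R x = 1) : x = 1 := by
  refine (IsLocalRing.eq_of_eval_eq_zero_of_not_isUnit_sub
    (f := Polynomial.X ^ n - Polynomial.C (1 : R)) (by simp) (by simp [hx]) ?_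
    (by simpa [Polynomial.derivative_X_pow] using hn)).symm
  rw [← mem_nonunits_iff, ← mem_maximalIdeal, ← residue_eq_zero_iff]
  simp [hx1]

variable (K : Type*) [Field K] [Algebra R K] [IsFractionRing R K]

/-- For `ϖ ≠ 0`, the map `Rˣ × ℤ → Kˣ`, `(u, n) ↦ u * ϖ ^ n`. -/
noncomputable def unitsMulZPow {ϖ : R} (hϖ : ϖ ≠ 0) : Rˣ × Multiplicative ℤ →* Kˣ :=
  (Units.map (algebraMap R K : R →* K)).coprod
    (zpowersHom Kˣ (Units.mk0 (algebraMap R K ϖ) (by simpa using hϖ)))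

theorem val_unitsMulZPow {ϖ : R} (hϖ : ϖ ≠ 0) (x : Rˣ × Multiplicative ℤ) :
    (unitsMulZPow K hϖ x : K) = algebraMap R K x.1 * algebraMap R K ϖ ^ x.2.toAdd := by
  simp [unitsMulZPow, zpowersHom_apply]

variable [IsDomain R] [IsDiscreteValuationRing R]

theorem unitsMulZPow_bijective {ϖ : R} (hϖ : Irreducible ϖ) :
    Function.Bijective (unitsMulZPow K hϖ.ne_zero) := by
  have hϖK : algebraMap R K ϖ ≠ 0 := by simpa using hϖ.ne_zero
  have hinj : ∀ (u v : Rˣ) (k : ℕ), (u : R) * ϖ ^ k = v → k = 0 ∧ u = v := fun u v k h ↦ by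
    obtain rfl : k = 0 := IsDiscreteValuationRing.unit_mul_pow_congr_pow hϖ hϖ u v k 0 (by simpa)
    exact ⟨rfl, Units.ext (by simpa using h)⟩
  constructor
  · rw [injective_iff_map_eq_one]
    rintro ⟨u, n⟩ h
    have h := congrArg Units.val h
    rw [val_unitsMulZPow, Units.val_one] at h
    obtain ⟨k, hk | hk⟩ := n.toAdd.eq_nat_or_neg
    · have := hinj u 1 k (IsFractionRing.injective R K (by simpa [hk] using h))
      ext <;> simp_all
    · have := hinj 1 u k (IsFractionRing.injective R K
        (by simpa [hk, mul_inv_eq_one₀ (pow_ne_zero _ hϖK), eq_comm] using h))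
      ext <;> simp_all
  · intro x
    obtain ⟨n, u, hx⟩ :=
      IsDiscreteValuationRing.exists_units_eq_smul_zpow_of_irreducible hϖ x.ne_zero
    refine ⟨(u, .ofAdd n), Units.ext ?_⟩
    simp [val_unitsMulZPow, hx, Units.smul_def, Algebra.smul_def]

/-- If `l` is prime and invertible in a Henselian discrete valuation ring with finite residue field
whose fraction field `K` contains a primitive `l`-th root of unity, then `Kˣ / (Kˣ) ^ l` has
order `l ^ 2`. -/
theorem index_range_powMonoidHom_units_fractionRing [HenselianLocalRing R]
    [Finite (IsLocalRing.ResidueField R)] {l : ℕ} (hl : l.Prime) (hlR : IsUnit (l : R))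
    {ζ : Kˣ} (hζ : orderOf ζ = l) :
    (powMonoidHom l : Kˣ →* Kˣ).range.index = l ^ 2 := by
  obtain ⟨ϖ, hϖ⟩ := IsDiscreteValuationRing.exists_irreducible R
  have hbij := unitsMulZPow_bijective K hϖ
  rw [← MonoidHom.index_range_powMonoidHom_eq_of_surjective _ hbij.2 l
      (by simp [(MonoidHom.ker_eq_bot_iff _).mpr hbij.1]),
    index_range_powMonoidHom_prod, index_range_powMonoidHom_multiplicative_int,
    index_range_powMonoidHom_units_of_henselian hlR, IsCyclic.index_powMonoidHom_range, sq,
    Nat.gcd_eq_right]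
  obtain ⟨⟨u, n⟩, rfl⟩ := hbij.2 ζ
  rw [orderOf_injective _ hbij.1] at hζ
  have hpow : (u, n) ^ l = 1 := hζ ▸ pow_orderOf_eq_one _
  obtain ⟨hu, hn⟩ : u ^ l = 1 ∧ n ^ l = 1 := by simpa [Prod.ext_iff] using hpow
  obtain rfl : n = 1 := (pow_eq_one_iff_left hl.ne_zero).mp hn
  have : Fact l.Prime := ⟨hl⟩
  let v := Units.map (IsLocalRing.residue R : R →* IsLocalRing.ResidueField R) u
  have hv : orderOf v = l := by
    refine orderOf_eq_prime (by rw [← map_pow, hu, map_one]) fun hv ↦ ?_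
    have : (u : R) = 1 := IsLocalRing.eq_one_of_pow_eq_one_of_residue_eq_one hlR
      (by simpa using congrArg Units.val hu) (by simpa [v] using congrArg Units.val hv)
    obtain rfl : u = 1 := Units.ext this
    exact hl.ne_one (by rw [← hζ]; exact orderOf_one)
  exact hv ▸ orderOf_dvd_natCard v

end DVR

open scoped Pointwise in
theorem isAdicComplete_maximalIdeal_of_compactSpace (R : Type*) [CommRing R] [IsLocalRing R]
    [IsNoetherianRing R] [TopologicalSpace R] [IsTopologicalRing R] [T2Space R] [CompactSpace R] :
    IsAdicComplete (IsLocalRing.maximalIdeal R) R where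
  prec' f hf := by
    let S n : Set R := f n +ᵥ ((IsLocalRing.maximalIdeal R ^ n : Ideal R) : Set R)
    have hS n : S (n + 1) ⊆ S n := by
      apply (Set.vadd_set_subset_vadd_set_iff.mpr (Ideal.pow_le_pow_right n.le_succ)).trans
      simpa [S] using (hf n.le_succ).symm
    have h n : IsClosed (S n) :=
      (IsNoetherianRing.isClosed_ideal (IsLocalRing.maximalIdeal R ^ n)).vadd (f n)
    obtain ⟨L, hL⟩ := (h 0).isCompact.nonempty_iInter_of_sequence_nonempty_isCompact_isClosed S hS
      (by simp [S]) h
    refine ⟨L, fun n ↦ ?_⟩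
    obtain ⟨y, hy, rfl⟩ := Set.mem_iInter.mp hL n
    simpa [SModEq.sub_mem] using hy

open scoped NormedField Valued in
theorem index_range_powMonoidHom_units_of_properSpace {K : Type*} [NontriviallyNormedField K]
    [IsUltrametricDist K] [ProperSpace K] {l : ℕ} (hl : l.Prime) (hlK : ‖(l : K)‖ = 1)
    {ζ : Kˣ} (hζ : orderOf ζ = l) :
    (powMonoidHom l : Kˣ →* Kˣ).range.index = l ^ 2 := by
  have : CompactSpace 𝒪[K] := by
    refine isCompact_iff_compactSpace.mp ?_
    convert isCompact_closedBall (0 : K) 1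
    ext x
    simp [Valued.integer.mem_iff]
  have : (Valued.v : Valuation K NNReal).RankOne :=
    inferInstanceAs (NormedField.valuation (K := K)).RankOne
  have : IsDiscreteValuationRing 𝒪[K] := Valued.integer.isDiscreteValuationRing_of_compactSpace
  have : Finite (IsLocalRing.ResidueField 𝒪[K]) :=
    (Valued.integer.compactSpace_iff_completeSpace_and_isDiscreteValuationRing_and_finite_residueField.mp
      inferInstance).2.2
  have : IsAdicComplete 𝓂[K] 𝒪[K] := isAdicComplete_maximalIdeal_of_compactSpace _
  have : HenselianLocalRing 𝒪[K] :=
    { is_henselian := fun f hf a₀ h₁ h₂ ↦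
        HenselianRing.is_henselian (I := 𝓂[K]) f hf a₀ h₁ (h₂.map (Ideal.Quotient.mk _)) }
  exact index_range_powMonoidHom_units_fractionRing (R := 𝒪[K]) K hl
    (Valued.integer.isUnit_iff_norm_eq_one.mpr (by simpa using! hlK)) hζ

/-- If `K` is a finite extension of `ℚ_p` containing a primitive `l`-th root
of unity, where `l ≠ p` is prime, then `Kˣ/(Kˣ)^l` has cardinality `l²`. -/
theorem card_units_quot_lth_powers_of_local_field_tame
    (p l : ℕ) [Fact p.Prime] (hl : l.Prime) (hpl : p ≠ l)
    (K : Type*) [Field K] [Algebra ℚ_[p] K] [FiniteDimensional ℚ_[p] K]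
    (hζ : ∃ ζ : Kˣ, orderOf ζ = l) :
    Nat.card (Kˣ ⧸ (powMonoidHom l : Kˣ →* Kˣ).range) = l ^ 2 := by
  obtain ⟨ζ, hζ⟩ := hζ
  let := spectralNorm.nontriviallyNormedField ℚ_[p] K
  let := spectralNorm.normedAlgebra ℚ_[p] K
  have : IsUltrametricDist K :=
    IsUltrametricDist.isUltrametricDist_of_isNonarchimedean_norm isNonarchimedean_spectralNorm
  have : ProperSpace K := FiniteDimensional.proper ℚ_[p] K
  refine index_range_powMonoidHom_units_of_properSpace hl ?_ hζ
  rw [← map_natCast (algebraMap ℚ_[p] K), norm_algebraMap']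
  exact Padic.norm_natCast_eq_one_iff.mpr ((Nat.coprime_primes Fact.out hl).mpr hpl)
end
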